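/- arXiv:0707.3401 — 2 statements merged into one kernel-verified Lean document; each statement's English description precedes it below -/
import Mathlib

section
/- Let {r_n}_{n≥1} be real numbers and let {z_{nk} : n ∈ ℕ, 1 ≤ k ≤ k_n}, {w_{nk}} be triangular arrays of complex numbers and {s_{nk}} a triangular array of real numbers such that: (i) all s_{nk} ≥ 0 and sup_{n≥1} Σ_{k=1}^{k_n} s_{nk} < +∞; (ii) Re w_{nk} ≤ 0 and Re z_{nk} ≤ 0 for all n, k; (iii) z_{nk} = w_{nk}(1+ε_{nk}) where ε_n := max_{1≤k≤k_n} |ε_{nk}| → 0 as n → ∞; (iv) there is M > 0 with |Im w_{nk}| ≤ M|Re w_{nk}| + s_{nk} for all n, k. Then the sequence exp(i r_n + Σ_{k=1}^{k_n} z_{nk}) converges in ℂ if and only if the sequence exp(i r_n + Σ_{k=1}^{k_n} w_{nk}) converges in ℂ, and when they converge the two sequences have the same limit. -/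
open Complex Filter Topology Finset

lemma norm_exp_sub_exp_le (a b : ℂ) :
    ‖Complex.exp a - Complex.exp b‖ ≤ Real.exp b.re * (‖a - b‖ * Real.exp ‖a - b‖) := by
  have h : Complex.exp a - Complex.exp b = Complex.exp b * (Complex.exp (a - b) - 1) := by
    rw [mul_sub, ← Complex.exp_add, add_sub_cancel, mul_one]
  rw [h, norm_mul, Complex.norm_exp]
  gcongr
  simpa using Complex.norm_exp_sub_sum_le_norm_mul_exp (a - b) 1

/-- If `‖a - b‖` is at most `δ` times an affine function of `-re b ≥ 0`, with `δ` small, then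
`exp a` and `exp b` differ by `O(δ)` uniformly in `b`. -/
lemma norm_exp_sub_exp_le_of_norm_sub_le {a b : ℂ} {δ K : ℝ} (hδ : 0 ≤ δ) (hδK : δ * K ≤ 1)
    (hK : 0 ≤ K) (hb : b.re ≤ 0) (h : ‖a - b‖ ≤ δ * (K * (-b.re / 2 + 1))) :
    ‖Complex.exp a - Complex.exp b‖ ≤ δ * (K * Real.exp 1) := by
  have h_exponent : ‖a - b‖ ≤ -b.re / 2 + 1 := by nlinarith
  calc ‖Complex.exp a - Complex.exp b‖
      ≤ Real.exp b.re * (‖a - b‖ * Real.exp ‖a - b‖) := norm_exp_sub_exp_le a b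
    _ ≤ Real.exp b.re * (δ * (K * Real.exp (-b.re / 2)) * Real.exp (-b.re / 2 + 1)) := by
        gcongr
        refine h.trans ?_
        gcongr
        exact Real.add_one_le_exp _
    _ = δ * (K * (Real.exp b.re * Real.exp (-b.re / 2) * Real.exp (-b.re / 2 + 1))) := by ring
    _ = δ * (K * Real.exp 1) := by
        rw [← Real.exp_add, ← Real.exp_add]
        ring_nf

lemma norm_sum_mul_one_add_sub_sum_le {ι : Type*} (t : Finset ι) {z w e : ι → ℂ} {s : ι → ℝ}
    {M δ : ℝ} (hδ : 0 ≤ δ) (hw : ∀ i ∈ t, (w i).re ≤ 0)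
    (hzw : ∀ i ∈ t, z i = w i * (1 + e i)) (he : ∀ i ∈ t, ‖e i‖ ≤ δ)
    (him : ∀ i ∈ t, |(w i).im| ≤ M * |(w i).re| + s i) :
    ‖∑ i ∈ t, z i - ∑ i ∈ t, w i‖ ≤
      δ * ((1 + M) * -(∑ i ∈ t, w i).re + ∑ i ∈ t, s i) := by
  rw [← Finset.sum_sub_distrib, Complex.re_sum, ← Finset.sum_neg_distrib, Finset.mul_sum,
    ← Finset.sum_add_distrib, Finset.mul_sum]
  refine norm_sum_le_of_le _ fun i hi => ?_
  have h : z i - w i = e i * w i := by rw [hzw i hi]; ring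
  rw [h, norm_mul]
  have hn := Complex.norm_le_abs_re_add_abs_im (w i)
  have hi' := him i hi
  rw [abs_of_nonpos (hw i hi)] at hn hi'
  exact mul_le_mul (he i hi) (by linarith) (norm_nonneg _) hδ

/-- Lemma 2.1: under conditions (i)-(iv), the sequences
`exp(i r_n + Σ_k z_{nk})` and `exp(i r_n + Σ_k w_{nk})` converge simultaneously
and to the same limit. -/
theorem stmt0
    (kn : ℕ → ℕ) (r : ℕ → ℝ) (z w ε : ℕ → ℕ → ℂ) (s : ℕ → ℕ → ℝ) (M : ℝ)
    -- (i) the s_{nk} are nonnegative with uniformly bounded row sums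
    (hs_nonneg : ∀ n : ℕ, ∀ i < kn n, 0 ≤ s n i)
    (hs_sup : ∃ C : ℝ, ∀ n : ℕ, ∑ i ∈ Finset.range (kn n), s n i ≤ C)
    -- (ii) nonpositive real parts
    (hw_re : ∀ n : ℕ, ∀ i < kn n, (w n i).re ≤ 0)
    (hz_re : ∀ n : ℕ, ∀ i < kn n, (z n i).re ≤ 0)
    -- (iii) z_{nk} = w_{nk}(1+ε_{nk}) with max_k |ε_{nk}| → 0
    (hzw : ∀ n : ℕ, ∀ i < kn n, z n i = w n i * (1 + ε n i))
    (hε : ∀ δ : ℝ, 0 < δ → ∃ N : ℕ, ∀ n ≥ N, ∀ i < kn n, ‖ε n i‖ < δ)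
    -- (iv) |Im w_{nk}| ≤ M |Re w_{nk}| + s_{nk}
    (hM : 0 < M)
    (him : ∀ n : ℕ, ∀ i < kn n, |(w n i).im| ≤ M * |(w n i).re| + s n i) :
    ∀ L : ℂ,
      Tendsto (fun n => Complex.exp (Complex.I * (r n) +
          ∑ i ∈ Finset.range (kn n), z n i)) atTop (𝓝 L) ↔
      Tendsto (fun n => Complex.exp (Complex.I * (r n) +
          ∑ i ∈ Finset.range (kn n), w n i)) atTop (𝓝 L) := by
  obtain ⟨C, hC⟩ := hs_sup
  have hC0 : 0 ≤ C :=
    (Finset.sum_nonneg fun i hi => hs_nonneg 0 i (Finset.mem_range.1 hi)).trans (hC 0)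
  set K : ℝ := 2 * (1 + M) + C with hK
  have hK0 : 0 < K := by positivity
  have hdiff : Tendsto (fun n =>
      Complex.exp (Complex.I * (r n) + ∑ i ∈ Finset.range (kn n), z n i) -
        Complex.exp (Complex.I * (r n) + ∑ i ∈ Finset.range (kn n), w n i)) atTop (𝓝 0) := by
    rw [Metric.tendsto_atTop]
    intro η hη
    set δ : ℝ := min (1 / K) (η / (2 * (K * Real.exp 1)))
    have hδ : 0 < δ := by positivity
    have hδK : δ * K ≤ 1 := (le_div_iff₀ hK0).1 (min_le_left _ _)
    have hδη : δ * (2 * (K * Real.exp 1)) ≤ η :=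
      (le_div_iff₀ (by positivity)).1 (min_le_right _ _)
    obtain ⟨N, hN⟩ := hε δ hδ
    refine ⟨N, fun n hn => ?_⟩
    have hre : (∑ i ∈ Finset.range (kn n), w n i).re ≤ 0 := by
      rw [Complex.re_sum]
      exact Finset.sum_nonpos fun i hi => hw_re n i (Finset.mem_range.1 hi)
    have hre_add : (Complex.I * (r n) + ∑ i ∈ Finset.range (kn n), w n i).re =
        (∑ i ∈ Finset.range (kn n), w n i).re := by simp
    have hsum := norm_sum_mul_one_add_sub_sum_le (Finset.range (kn n)) hδ.le
      (fun i hi => hw_re n i (Finset.mem_range.1 hi))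
      (fun i hi => hzw n i (Finset.mem_range.1 hi))
      (fun i hi => (hN n hn i (Finset.mem_range.1 hi)).le)
      (fun i hi => him n i (Finset.mem_range.1 hi))
    have hbound := norm_exp_sub_exp_le_of_norm_sub_le
      (a := Complex.I * (r n) + ∑ i ∈ Finset.range (kn n), z n i)
      hδ.le hδK hK0.le (hre_add.trans_le hre) (by
        rw [hre_add, add_sub_add_left_eq_sub]
        refine hsum.trans ?_
        gcongr
        nlinarith [hC n, mul_nonneg hC0 (neg_nonneg.2 hre)])
    rw [dist_zero_right]
    linarith
  intro L
  constructor <;> intro h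
  · simpa using h.sub hdiff
  · simpa using h.add hdiff
end

section
/- Fix τ ∈ (0,π) and ε ∈ (0,1/4), and let V_ε = {z ∈ 𝔻 : |z| < ε}. For an infinitesimal array {μ_{nk}} of probability measures on 𝕋, there exist N ∈ ℕ and functions v_{nk} : V_ε → ℂ such that for all n ≥ N, 1 ≤ k ≤ k_n and z ∈ V_ε one has 1 − B_{μ_{nk}°}(z) = h_{nk}(b_{nk}^{-1} z)·(1 + v_{nk}(z)), and moreover lim_{n→∞} max_{1≤k≤k_n} sup_{z∈V_ε} |v_{nk}(z)| = 0. -/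
open MeasureTheory Complex Filter Topology Metric

noncomputable section

instance : MeasurableSpace Circle := borel Circle
instance : BorelSpace Circle := ⟨rfl⟩

/-- ψ_μ(z) = ∫ ζz/(1-ζz) dμ(ζ). -/
def psiT (μ : Measure Circle) (z : ℂ) : ℂ :=
  ∫ ζ : Circle, ((ζ : ℂ) * z) / (1 - (ζ : ℂ) * z) ∂μ

/-- The B-transform of a measure on the circle:
B_μ(z) = (1/z)·ψ_μ(z)/(1+ψ_μ(z)) for z ≠ 0 and B_μ(0) = ∫ ζ dμ. -/
def BT (μ : Measure Circle) (z : ℂ) : ℂ :=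
  if z = 0 then ∫ ζ : Circle, (ζ : ℂ) ∂μ
  else z⁻¹ * (psiT μ z / (1 + psiT μ z))

/-- Infinitesimal triangular array: max_{1≤k≤k_n} μ_{nk}{|ζ-1| ≥ ε} → 0 as n → ∞. -/
def IsInfinitesimalArrayT (kn : ℕ → ℕ) (μ : ℕ → ℕ → Measure Circle) : Prop :=
  ∀ ε : ℝ, 0 < ε → ∀ δ : ENNReal, 0 < δ → ∃ N : ℕ, ∀ n ≥ N, ∀ i < kn n,
    μ n i {ζ : Circle | ε ≤ ‖(ζ : ℂ) - 1‖} < δ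

/-- β = ∫_{|arg ζ|<τ} arg ζ dμ. -/
def betaT (τ : ℝ) (μ : Measure Circle) : ℝ :=
  ∫ ζ in {ζ : Circle | |Complex.arg (ζ : ℂ)| < τ}, Complex.arg (ζ : ℂ) ∂μ

/-- b = e^{iβ} as an element of the circle. -/
def bT (τ : ℝ) (μ : Measure Circle) : Circle := Circle.exp (betaT τ μ)

/-- μ° : the centering of μ, i.e. the pushforward of μ under ζ ↦ b⁻¹ ζ. -/
def centerT (τ : ℝ) (μ : Measure Circle) : Measure Circle :=
  Measure.map (fun ζ => (bT τ μ)⁻¹ * ζ) μ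

/-- h(z) = -i ∫ Im ζ dμ° + ∫ (1+ζz)/(1-ζz)·(1-Re ζ) dμ°, for the centered measure μ°. -/
def hT (τ : ℝ) (μ : Measure Circle) (z : ℂ) : ℂ :=
  -Complex.I * ((∫ ζ : Circle, ((ζ : ℂ)).im ∂(centerT τ μ) : ℝ) : ℂ) +
    ∫ ζ : Circle, ((1 + (ζ : ℂ) * z) / (1 - (ζ : ℂ) * z)) * ((1 - ((ζ : ℂ)).re : ℝ) : ℂ)
      ∂(centerT τ μ)

lemma one_sub_circle_mul_ne_zero {z : ℂ} (hz : ‖z‖ < 1) (ζ : Circle) :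
    1 - (ζ : ℂ) * z ≠ 0 := by
  intro h
  have h1 : ‖(ζ : ℂ) * z‖ = 1 := by rw [← sub_eq_zero.mp h, norm_one]
  rw [norm_mul, Circle.norm_coe, one_mul] at h1
  exact hz.ne h1

lemma le_norm_one_sub_circle_mul (z : ℂ) (ζ : Circle) : 1 - ‖z‖ ≤ ‖1 - (ζ : ℂ) * z‖ := by
  have h := norm_sub_norm_le (1 : ℂ) ((ζ : ℂ) * z)
  rwa [norm_one, norm_mul, Circle.norm_coe, one_mul] at h

lemma Continuous.integrable_circle {E : Type*} [NormedAddCommGroup E] {f : Circle → E}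
    (hf : Continuous f) (ν : Measure Circle) [IsFiniteMeasure ν] : Integrable f ν :=
  hf.integrable_of_hasCompactSupport (HasCompactSupport.of_compactSpace f)

lemma continuous_circle_div {f : Circle → ℂ} (hf : Continuous f) {z : ℂ} (hz : ‖z‖ < 1) :
    Continuous fun ζ : Circle => f ζ / (1 - (ζ : ℂ) * z) :=
  hf.div (by fun_prop) (one_sub_circle_mul_ne_zero hz)

/-- The integrand of `hT`. -/
def hKernel (z : ℂ) (ζ : Circle) : ℂ :=
  -Complex.I * ((ζ : ℂ).im : ℂ) +
    ((1 + (ζ : ℂ) * z) / (1 - (ζ : ℂ) * z)) * ((1 - (ζ : ℂ).re : ℝ) : ℂ)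

lemma continuous_hKernel {z : ℂ} (hz : ‖z‖ < 1) : Continuous (hKernel z) := by
  have h := continuous_circle_div (f := fun ζ => 1 + (ζ : ℂ) * z) (by fun_prop) hz
  unfold hKernel
  fun_prop

lemma circle_re_sq_add_im_sq (ζ : Circle) : (ζ : ℂ).re ^ 2 + (ζ : ℂ).im ^ 2 = 1 := by
  have h := Circle.normSq_coe ζ
  rw [Complex.normSq_apply] at h
  linarith

lemma circle_re_le_one (ζ : Circle) : (ζ : ℂ).re ≤ 1 := by
  nlinarith [circle_re_sq_add_im_sq ζ, sq_nonneg ((ζ : ℂ).im)]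

lemma hKernel_eq {z : ℂ} (hz : ‖z‖ < 1) (ζ : Circle) :
    hKernel z ζ = (1 - z) * ((1 - (ζ : ℂ)) / (1 - (ζ : ℂ) * z)) := by
  have h0 := one_sub_circle_mul_ne_zero hz ζ
  have hsq : ((ζ : ℂ).re : ℂ) ^ 2 + ((ζ : ℂ).im : ℂ) ^ 2 = 1 := by
    exact_mod_cast circle_re_sq_add_im_sq ζ
  have hre := Complex.re_add_im (ζ : ℂ)
  unfold hKernel
  generalize ((ζ : ℂ).re : ℝ) = x at *
  generalize ((ζ : ℂ).im : ℝ) = y at *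
  rw [← hre] at h0 ⊢
  rw [div_mul_eq_mul_div, ← mul_div_assoc, eq_div_iff h0, add_mul, div_mul_cancel₀ _ h0]
  push_cast
  linear_combination z * (y : ℂ) ^ 2 * Complex.I_sq - z * hsq

lemma norm_hKernel_sub_le {z w : ℂ} (hz : ‖z‖ < 1 / 4) (hw : ‖w‖ < 1 / 4) (ζ : Circle) :
    ‖hKernel z ζ - hKernel w ζ‖ ≤ 4 * ‖z - w‖ * (1 - (ζ : ℂ).re) := by
  have hz0 := one_sub_circle_mul_ne_zero (hz.trans (by norm_num)) ζ
  have hw0 := one_sub_circle_mul_ne_zero (hw.trans (by norm_num)) ζ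
  have hz1 := le_norm_one_sub_circle_mul z ζ
  have hw1 := le_norm_one_sub_circle_mul w ζ
  have hR : 0 ≤ 1 - (ζ : ℂ).re := sub_nonneg.mpr (circle_re_le_one ζ)
  have heq : hKernel z ζ - hKernel w ζ =
      2 * (ζ : ℂ) * (z - w) / ((1 - (ζ : ℂ) * z) * (1 - (ζ : ℂ) * w)) *
        ((1 - (ζ : ℂ).re : ℝ) : ℂ) := by
    unfold hKernel
    field_simp
    ring
  rw [heq, norm_mul, norm_div, norm_mul, norm_mul, norm_mul, Circle.norm_coe, Complex.norm_real,
    Real.norm_of_nonneg hR]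
  refine mul_le_mul_of_nonneg_right ?_ hR
  have hden : 1 / 2 ≤ ‖1 - (ζ : ℂ) * z‖ * ‖1 - (ζ : ℂ) * w‖ := by nlinarith
  rw [div_le_iff₀ (by linarith)]
  norm_num
  nlinarith [norm_nonneg (z - w)]

lemma half_mul_le_re_hKernel {z : ℂ} (hz : ‖z‖ < 1 / 4) (ζ : Circle) :
    1 / 2 * (1 - (ζ : ℂ).re) ≤ (hKernel z ζ).re := by
  have hz0 := one_sub_circle_mul_ne_zero (hz.trans (by norm_num)) ζ
  have hR : 0 ≤ 1 - (ζ : ℂ).re := sub_nonneg.mpr (circle_re_le_one ζ)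
  have hre : (hKernel z ζ).re =
      ((1 + (ζ : ℂ) * z) / (1 - (ζ : ℂ) * z)).re * (1 - (ζ : ℂ).re) := by
    unfold hKernel
    rw [Complex.add_re, Complex.re_mul_ofReal]
    simp
  rw [hre]
  refine mul_le_mul_of_nonneg_right ?_ hR
  have hu : ‖(ζ : ℂ) * z‖ < 1 / 4 := by rwa [norm_mul, Circle.norm_coe, one_mul]
  generalize (ζ : ℂ) * z = u at *
  have hn : Complex.normSq (1 - u) = (1 - u.re) ^ 2 + u.im ^ 2 := by
    rw [Complex.normSq_apply]; simp; ring
  have hpos : 0 < (1 - u.re) ^ 2 + u.im ^ 2 := hn ▸ Complex.normSq_pos.mpr hz0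
  have hsq : u.re ^ 2 + u.im ^ 2 < 1 / 16 := by
    have := Complex.normSq_eq_norm_sq u
    rw [Complex.normSq_apply] at this
    nlinarith [norm_nonneg u]
  rw [Complex.div_re, hn, ← add_div, le_div_iff₀ hpos]
  simp
  nlinarith [abs_lt.mp (abs_lt_of_sq_lt_sq (a := u.re) (b := 1 / 4) (by nlinarith) (by norm_num))]

section ProbabilityMeasure

variable (ν : Measure Circle) [IsProbabilityMeasure ν]

lemma one_add_integral {f : Circle → ℂ} (hf : Integrable f ν) :
    1 + ∫ ζ, f ζ ∂ν = ∫ ζ, (1 + f ζ) ∂ν := by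
  rw [integral_add (integrable_const _) hf]
  simp

lemma one_sub_mul_one_add_psiT {z : ℂ} (hz : ‖z‖ < 1) :
    (1 - z) * (1 + psiT ν z) = 1 + ∫ ζ : Circle, ((ζ : ℂ) - 1) * z / (1 - (ζ : ℂ) * z) ∂ν := by
  have hψ := (continuous_circle_div (f := fun ζ => (ζ : ℂ) * z)
    (by fun_prop) hz).integrable_circle ν
  have hq := (continuous_circle_div (f := fun ζ => ((ζ : ℂ) - 1) * z)
    (by fun_prop) hz).integrable_circle ν
  rw [psiT, one_add_integral ν hψ, one_add_integral ν hq, ← integral_const_mul]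
  congr 1 with ζ
  have h0 := one_sub_circle_mul_ne_zero hz ζ
  rw [one_add_div h0, one_add_div h0, ← mul_div_assoc]
  ring

lemma one_sub_BT_mul {z : ℂ} (hz : ‖z‖ < 1) (h1 : 1 + psiT ν z ≠ 0) :
    (1 - BT ν z) * ((1 - z) * (1 + psiT ν z)) = ∫ ζ, hKernel z ζ ∂ν := by
  have hψ := (continuous_circle_div (f := fun ζ => (ζ : ℂ) * z)
    (by fun_prop) hz).integrable_circle ν
  have hc : Integrable (fun _ : Circle => (1 : ℂ)) ν := integrable_const _
  simp_rw [hKernel_eq hz]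
  rw [integral_const_mul]
  by_cases hz0 : z = 0
  · subst hz0
    have hi : Integrable (fun ζ : Circle => (ζ : ℂ)) ν :=
      Continuous.integrable_circle (by fun_prop) ν
    simp [BT, psiT, integral_sub hc hi]
  · have key : ∫ ζ : Circle, (1 - (ζ : ℂ)) / (1 - (ζ : ℂ) * z) ∂ν =
        (1 + psiT ν z) - z⁻¹ * psiT ν z := by
      have hs : Integrable (fun ζ : Circle => 1 + (ζ : ℂ) * z / (1 - (ζ : ℂ) * z)) ν := hc.add hψ
      rw [psiT, one_add_integral ν hψ, ← integral_const_mul,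
        ← integral_sub hs (hψ.const_mul _)]
      congr 1 with ζ
      rw [one_add_div (one_sub_circle_mul_ne_zero hz ζ), ← mul_div_assoc, ← sub_div,
        mul_left_comm, inv_mul_cancel₀ hz0]
      ring
    rw [key, BT, if_neg hz0]
    field_simp

lemma norm_integral_hKernel_sub_le {z w : ℂ} (hz : ‖z‖ < 1 / 4) (hw : ‖w‖ < 1 / 4) :
    ‖(∫ ζ, hKernel z ζ ∂ν) - ∫ ζ, hKernel w ζ ∂ν‖ ≤ 8 * ‖z - w‖ * ‖∫ ζ, hKernel w ζ ∂ν‖ := by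
  have iz := (continuous_hKernel (hz.trans (by norm_num))).integrable_circle ν
  have iw := (continuous_hKernel (hw.trans (by norm_num))).integrable_circle ν
  have ir : Integrable (fun ζ : Circle => 1 - (ζ : ℂ).re) ν :=
    Continuous.integrable_circle (by fun_prop) ν
  have hlow : 1 / 2 * ∫ ζ : Circle, (1 - (ζ : ℂ).re) ∂ν ≤ ‖∫ ζ, hKernel w ζ ∂ν‖ := by
    rw [← integral_const_mul]
    refine (integral_mono (ir.const_mul _) iw.re (half_mul_le_re_hKernel hw)).trans ?_
    have : ∫ ζ, RCLike.re (hKernel w ζ) ∂ν = (∫ ζ, hKernel w ζ ∂ν).re := integral_re iw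
    exact this.trans_le (Complex.re_le_norm _)
  rw [← integral_sub iz iw]
  refine (norm_integral_le_of_norm_le (ir.const_mul (4 * ‖z - w‖))
    (.of_forall (norm_hKernel_sub_le hz hw))).trans ?_
  rw [integral_const_mul]
  nlinarith [norm_nonneg (z - w), mul_le_mul_of_nonneg_left hlow (norm_nonneg (z - w))]

lemma norm_one_sub_mul_one_add_psiT_sub_one_le {z : ℂ} (hz : ‖z‖ < 1 / 4) :
    ‖(1 - z) * (1 + psiT ν z) - 1‖ ≤ 1 / 3 * ∫ ζ : Circle, ‖(ζ : ℂ) - 1‖ ∂ν := by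
  rw [one_sub_mul_one_add_psiT ν (hz.trans (by norm_num)), add_sub_cancel_left,
    ← integral_const_mul]
  refine norm_integral_le_of_norm_le (Continuous.integrable_circle (by fun_prop) ν)
    (.of_forall fun ζ => ?_)
  have h := le_norm_one_sub_circle_mul z ζ
  rw [norm_div, norm_mul, div_le_iff₀ (by linarith)]
  nlinarith [norm_nonneg ((ζ : ℂ) - 1)]

/-- Comparison of `1 - B_ν` at `z` with the integral of the kernel at a nearby point `w`. -/
lemma exists_one_sub_BT_eq {z w : ℂ} (hz : ‖z‖ < 1 / 4) (hw : ‖w‖ < 1 / 4) {m : ℝ}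
    (hm : m ≤ 1 / 2) (hν : ∫ ζ : Circle, ‖(ζ : ℂ) - 1‖ ∂ν ≤ 3 * m) (hzw : ‖z - w‖ ≤ m) :
    ∃ v : ℂ, 1 - BT ν z = (∫ ζ, hKernel w ζ ∂ν) * (1 + v) ∧ ‖v‖ ≤ 18 * m := by
  have hq : ‖(1 - z) * (1 + psiT ν z) - 1‖ ≤ m :=
    (norm_one_sub_mul_one_add_psiT_sub_one_le ν hz).trans (by linarith)
  have hd := norm_integral_hKernel_sub_le ν hz hw
  have hm0 : 0 ≤ m := (norm_nonneg _).trans hzw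
  have hD : 1 / 2 ≤ ‖(1 - z) * (1 + psiT ν z)‖ := by
    have := norm_sub_norm_le (1 : ℂ) ((1 : ℂ) - (1 - z) * (1 + psiT ν z))
    rw [norm_sub_rev (1 : ℂ) ((1 - z) * (1 + psiT ν z)), sub_sub_cancel, norm_one] at this
    linarith
  have hD0 : (1 - z) * (1 + psiT ν z) ≠ 0 := norm_pos_iff.mp (by linarith)
  have hB := one_sub_BT_mul ν (hz.trans (by norm_num)) (right_ne_zero_of_mul hD0)
  generalize (1 - z) * (1 + psiT ν z) = D at *
  generalize ∫ ζ, hKernel z ζ ∂ν = H at *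
  generalize ∫ ζ, hKernel w ζ ∂ν = K at *
  have hd' : ‖H - K‖ ≤ 8 * m * ‖K‖ :=
    hd.trans (mul_le_mul_of_nonneg_right (by linarith) (norm_nonneg K))
  by_cases hK : K = 0
  · subst hK
    have hH : H = 0 := by simpa using hd'
    refine ⟨0, ?_, by simpa using hm0⟩
    rw [hH] at hB
    simpa [hD0] using hB
  · refine ⟨((H - K) / K - (D - 1)) / D, ?_, ?_⟩
    · rw [eq_div_of_mul_eq hD0 hB]
      field_simp
      ring
    · rw [norm_div, div_le_iff₀ (by linarith)]
      have h1 : ‖(H - K) / K‖ ≤ 8 * m := by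
        rwa [norm_div, div_le_iff₀ (norm_pos_iff.mpr hK)]
      have h2 := norm_sub_le ((H - K) / K) (D - 1)
      nlinarith

instance (τ : ℝ) : IsProbabilityMeasure (centerT τ ν) :=
  Measure.isProbabilityMeasure_map (by fun_prop)

lemma hT_eq_integral_hKernel (τ : ℝ) {z : ℂ} (hz : ‖z‖ < 1) :
    hT τ ν z = ∫ ζ, hKernel z ζ ∂(centerT τ ν) := by
  have h := continuous_circle_div (f := fun ζ => 1 + (ζ : ℂ) * z) (by fun_prop) hz
  unfold hT hKernel
  rw [integral_add (Continuous.integrable_circle (by fun_prop) _)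
    (Continuous.integrable_circle (by fun_prop) _), integral_const_mul, integral_complex_ofReal]

lemma abs_betaT_le (τ : ℝ) : |betaT τ ν| ≤ 2 * ∫ ζ : Circle, ‖(ζ : ℂ) - 1‖ ∂ν := by
  have hi : Integrable (fun ζ : Circle => 2 * ‖(ζ : ℂ) - 1‖) ν :=
    Continuous.integrable_circle (by fun_prop) ν
  rw [← integral_const_mul, betaT, ← Real.norm_eq_abs]
  refine (norm_integral_le_of_norm_le hi.integrableOn (.of_forall fun ζ => ?_)).trans
    (setIntegral_le_integral hi (.of_forall fun ζ => by positivity))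
  have h := Complex.angle_le_mul_norm_sub (x := 1) (y := (ζ : ℂ)) norm_one (Circle.norm_coe ζ)
  rw [Complex.angle_one_left ζ.coe_ne_zero, norm_sub_rev] at h
  rw [Real.norm_eq_abs]
  nlinarith [Real.pi_le_four, norm_nonneg ((ζ : ℂ) - 1)]

lemma norm_bT_sub_one_le (τ : ℝ) :
    ‖(bT τ ν : ℂ) - 1‖ ≤ 2 * ∫ ζ : Circle, ‖(ζ : ℂ) - 1‖ ∂ν := by
  refine le_trans ?_ (abs_betaT_le ν τ)
  rw [bT, Circle.coe_exp, mul_comm]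
  simpa using Real.norm_exp_I_mul_ofReal_sub_one_le (x := betaT τ ν)

lemma norm_inv_mul_sub (b : Circle) (x y : ℂ) :
    ‖(b : ℂ)⁻¹ * x - y‖ = ‖x - b * y‖ := by
  have : (b : ℂ)⁻¹ * x - y = (b : ℂ)⁻¹ * (x - b * y) := by
    field_simp [b.coe_ne_zero]
  rw [this, norm_mul, norm_inv, Circle.norm_coe, inv_one, one_mul]

lemma integral_norm_sub_one_centerT_le (τ : ℝ) :
    ∫ ζ : Circle, ‖(ζ : ℂ) - 1‖ ∂(centerT τ ν) ≤ 3 * ∫ ζ : Circle, ‖(ζ : ℂ) - 1‖ ∂ν := by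
  have hi : Integrable (fun ζ : Circle => ‖(ζ : ℂ) - 1‖) ν :=
    Continuous.integrable_circle (by fun_prop) ν
  rw [centerT, integral_map (by fun_prop)
    (Continuous.aestronglyMeasurable (by fun_prop))]
  have hle : ∫ ζ : Circle, ‖(((bT τ ν)⁻¹ * ζ : Circle) : ℂ) - 1‖ ∂ν ≤
      ∫ ζ : Circle, (‖(ζ : ℂ) - 1‖ + ‖(bT τ ν : ℂ) - 1‖) ∂ν := by
    refine integral_mono (Continuous.integrable_circle (by fun_prop) ν)
      (hi.add (integrable_const _)) fun ζ => ?_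
    dsimp only
    rw [Circle.coe_mul, Circle.coe_inv, norm_inv_mul_sub, mul_one]
    simpa using norm_sub_le ((ζ : ℂ) - 1) ((bT τ ν : ℂ) - 1)
  rw [integral_add hi (integrable_const _)] at hle
  simp only [integral_const, probReal_univ, one_smul] at hle
  linarith [norm_bT_sub_one_le ν τ]

lemma exists_one_sub_BT_centerT_eq (τ : ℝ) {z : ℂ} (hz : ‖z‖ < 1 / 4)
    (hm : ∫ ζ : Circle, ‖(ζ : ℂ) - 1‖ ∂ν ≤ 1 / 2) :
    ∃ v : ℂ, 1 - BT (centerT τ ν) z = hT τ ν ((bT τ ν : ℂ)⁻¹ * z) * (1 + v) ∧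
      ‖v‖ ≤ 18 * ∫ ζ : Circle, ‖(ζ : ℂ) - 1‖ ∂ν := by
  have hw : ‖(bT τ ν : ℂ)⁻¹ * z‖ < 1 / 4 := by
    rwa [norm_mul, norm_inv, Circle.norm_coe, inv_one, one_mul]
  rw [hT_eq_integral_hKernel ν τ (hw.trans (by norm_num))]
  refine exists_one_sub_BT_eq _ hz hw hm (integral_norm_sub_one_centerT_le ν τ) ?_
  rw [norm_sub_rev, norm_inv_mul_sub, norm_sub_rev, ← sub_one_mul, norm_mul]
  nlinarith [norm_bT_sub_one_le ν τ, norm_nonneg ((bT τ ν : ℂ) - 1), norm_nonneg z]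

lemma integral_norm_sub_one_le {η : ℝ} (hη : 0 ≤ η) :
    ∫ ζ : Circle, ‖(ζ : ℂ) - 1‖ ∂ν ≤ η + 2 * ν.real {ζ : Circle | η ≤ ‖(ζ : ℂ) - 1‖} := by
  have hs : MeasurableSet {ζ : Circle | η ≤ ‖(ζ : ℂ) - 1‖} :=
    (isClosed_le (by fun_prop) (by fun_prop)).measurableSet
  have hind := (integrable_indicator_iff (μ := ν) (f := fun _ => (2 : ℝ)) hs).mpr
    (integrable_const _)
  have hle : ∫ ζ : Circle, ‖(ζ : ℂ) - 1‖ ∂ν ≤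
      ∫ ζ : Circle, (η + {ζ : Circle | η ≤ ‖(ζ : ℂ) - 1‖}.indicator (fun _ => (2 : ℝ)) ζ) ∂ν := by
    refine integral_mono (Continuous.integrable_circle (by fun_prop) ν)
      ((integrable_const _).add hind) fun ζ => ?_
    dsimp only
    by_cases h : η ≤ ‖(ζ : ℂ) - 1‖
    · rw [Set.indicator_of_mem (by exact h)]
      have := norm_sub_le (ζ : ℂ) 1
      rw [Circle.norm_coe, norm_one] at this
      linarith
    · rw [Set.indicator_of_notMem (by exact h)]
      linarith
  rw [integral_add (integrable_const _) hind, integral_indicator hs] at hle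
  simpa [mul_comm] using hle

end ProbabilityMeasure

lemma IsInfinitesimalArrayT.exists_integral_norm_sub_one_lt {kn : ℕ → ℕ}
    {μ : ℕ → ℕ → Measure Circle} (hinf : IsInfinitesimalArrayT kn μ)
    (hprob : ∀ n i, IsProbabilityMeasure (μ n i)) {δ : ℝ} (hδ : 0 < δ) :
    ∃ N : ℕ, ∀ n ≥ N, ∀ i < kn n, ∫ ζ : Circle, ‖(ζ : ℂ) - 1‖ ∂(μ n i) < δ := by
  obtain ⟨N, hN⟩ := hinf (δ / 2) (by positivity) (ENNReal.ofReal (δ / 4)) (by simpa using hδ)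
  refine ⟨N, fun n hn i hi => ?_⟩
  have := hprob n i
  have h1 := integral_norm_sub_one_le (μ n i) (η := δ / 2) (by positivity)
  have h2 : (μ n i).real {ζ : Circle | δ / 2 ≤ ‖(ζ : ℂ) - 1‖} < δ / 4 :=
    (ENNReal.lt_ofReal_iff_toReal_lt (measure_ne_top _ _)).mp (hN n hn i hi)
  linarith

/-- Lemma 3.1: for an infinitesimal array on the circle,
1 − B_{μ_{nk}°}(z) = h_{nk}(b_{nk}⁻¹ z)(1 + v_{nk}(z)) on V_ε = {|z| < ε},
with max_{1≤k≤k_n} sup_{V_ε} |v_{nk}| → 0. -/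
theorem stmt1
    (τ : ℝ) (hτ : 0 < τ ∧ τ < Real.pi)
    (ε : ℝ) (hε : 0 < ε ∧ ε < 1/4)
    (kn : ℕ → ℕ) (μ : ℕ → ℕ → Measure Circle)
    (hprob : ∀ n i, IsProbabilityMeasure (μ n i))
    (hinf : IsInfinitesimalArrayT kn μ) :
    ∃ N : ℕ, ∃ v : ℕ → ℕ → ℂ → ℂ,
      (∀ n ≥ N, ∀ i < kn n, ∀ z : ℂ, ‖z‖ < ε →
        1 - BT (centerT τ (μ n i)) z
          = hT τ (μ n i) (((bT τ (μ n i) : Circle) : ℂ)⁻¹ * z) * (1 + v n i z)) ∧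
      (∀ δ : ℝ, 0 < δ → ∃ N' : ℕ, ∀ n ≥ N', ∀ i < kn n, ∀ z : ℂ, ‖z‖ < ε →
        ‖v n i z‖ < δ) := by
  obtain ⟨N, hN⟩ := hinf.exists_integral_norm_sub_one_lt hprob (δ := 1 / 2) (by norm_num)
  have hex : ∀ n i z, ∃ v : ℂ, N ≤ n → i < kn n → ‖z‖ < ε →
      1 - BT (centerT τ (μ n i)) z = hT τ (μ n i) ((bT τ (μ n i) : ℂ)⁻¹ * z) * (1 + v) ∧
        ‖v‖ ≤ 18 * ∫ ζ : Circle, ‖(ζ : ℂ) - 1‖ ∂(μ n i) := by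
    intro n i z
    by_cases h : N ≤ n ∧ i < kn n ∧ ‖z‖ < ε
    · have := hprob n i
      obtain ⟨v, hv⟩ := exists_one_sub_BT_centerT_eq (μ n i) τ (h.2.2.trans hε.2)
        (hN n h.1 i h.2.1).le
      exact ⟨v, fun _ _ _ => hv⟩
    · exact ⟨0, fun h1 h2 h3 => absurd ⟨h1, h2, h3⟩ h⟩
  choose v hv using hex
  refine ⟨N, v, fun n hn i hi z hz => (hv n i z hn hi hz).1, fun δ hδ => ?_⟩
  obtain ⟨M, hM⟩ := hinf.exists_integral_norm_sub_one_lt hprob (δ := δ / 18) (by positivity)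
  refine ⟨max N M, fun n hn i hi z hz => ?_⟩
  have h1 := (hv n i z (le_of_max_le_left hn) hi hz).2
  have h2 := hM n (le_of_max_le_right hn) i hi
  linarith

end
end
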